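/- arXiv:1911.05982 — 2 statements merged into one kernel-verified Lean document; each statement's English description precedes it below -/
import Mathlib

section
/- The gradient system of the continuous Hahn Morse function preserves parity symmetry: if x : [0,∞) → ℝⁿ is a differentiable solution of dx_j/dt = −∂V/∂x_j (j = 1,…,n) whose initial condition satisfies x_j(0) + x_{n+1−j}(0) = 0 for all j = 1,…,n, then x_j(t) + x_{n+1−j}(t) = 0 for all j = 1,…,n and all t ≥ 0. -/
/-- `g_a(θ) = (1/2)(arctan((θ+Im a)/Re a) + arctan((θ−Im a)/Re a))`. -/
noncomputable def gfun (a : ℂ) (θ : ℝ) : ℝ :=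
  (Real.arctan ((θ + a.im) / a.re) + Real.arctan ((θ - a.im) / a.re)) / 2

/-- `G_a(s) = ∫₀ˢ g_a(θ) dθ`. -/
noncomputable def Gfun (a : ℂ) (s : ℝ) : ℝ := ∫ θ in (0:ℝ)..s, gfun a θ

/-- `F(s) = ∫₀ˢ arctan(θ) dθ`. -/
noncomputable def Ffun (s : ℝ) : ℝ := ∫ θ in (0:ℝ)..s, Real.arctan θ

/-- The continuous Hahn Morse function
`V(x) = Σ_{j<k} F(x_j − x_k) + Σ_j (G_a(x_j) + G_b(x_j) + (π/2)(n+1−2j)x_j)`,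
with `j, k` running through `1, …, n` (so a Lean index `j : Fin n` corresponds to `j+1`). -/
noncomputable def V (n : ℕ) (a b : ℂ) (x : Fin n → ℝ) : ℝ :=
  (∑ j : Fin n, ∑ k : Fin n, if j < k then Ffun (x j - x k) else 0)
  + ∑ j : Fin n, (Gfun a (x j) + Gfun b (x j)
      + (Real.pi / 2) * ((n : ℝ) + 1 - 2 * (((j : ℕ) : ℝ) + 1)) * x j)

/-- Either `a` and `b` are both real, or `b = conj a`. -/
def PairCond (a b : ℂ) : Prop := (a.im = 0 ∧ b.im = 0) ∨ b = (starRingEnd ℂ) a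

theorem abs_arctan_sub_arctan_le (u w : ℝ) :
    |Real.arctan u - Real.arctan w| ≤ |u - w| := by
  have h : LipschitzWith 1 Real.arctan := by
    refine lipschitzWith_of_nnnorm_deriv_le Real.differentiable_arctan fun x => ?_
    rw [← NNReal.coe_le_coe, coe_nnnorm, Real.deriv_arctan, Real.norm_eq_abs,
      abs_of_nonneg (by positivity)]
    exact div_le_one_of_le₀ (by nlinarith [sq_nonneg x]) (by positivity)
  simpa [Real.dist_eq] using h.dist_le_mul u w

theorem gfun_neg (a : ℂ) (θ : ℝ) : gfun a (-θ) = -gfun a θ := by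
  have h₁ : (-θ + a.im) / a.re = -((θ - a.im) / a.re) := by ring
  have h₂ : (-θ - a.im) / a.re = -((θ + a.im) / a.re) := by ring
  simp only [gfun, h₁, h₂, Real.arctan_neg]
  ring

theorem abs_gfun_sub_gfun_le {a : ℂ} (ha : 0 < a.re) (u w : ℝ) :
    |gfun a u - gfun a w| ≤ a.re⁻¹ * |u - w| := by
  have key (c : ℝ) : |Real.arctan ((u + c) / a.re) - Real.arctan ((w + c) / a.re)|
      ≤ a.re⁻¹ * |u - w| := by
    refine (abs_arctan_sub_arctan_le _ _).trans_eq ?_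
    rw [show (u + c) / a.re - (w + c) / a.re = a.re⁻¹ * (u - w) by ring, abs_mul,
      abs_of_pos (inv_pos.2 ha)]
  have h₁ := abs_le.1 (key a.im)
  have h₂ := abs_le.1 (key (-a.im))
  simp only [← sub_eq_add_neg] at h₂
  simp only [gfun]
  rw [abs_le]
  constructor <;> linarith [h₁.1, h₁.2, h₂.1, h₂.2]

/-- The continuous Hahn gradient vector field `-∇V`. -/
noncomputable def hahnField (n : ℕ) (a b : ℂ) (y : Fin n → ℝ) (j : Fin n) : ℝ :=
  -((Real.pi / 2) * ((n : ℝ) + 1 - 2 * (((j : ℕ) : ℝ) + 1))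
    + gfun a (y j) + gfun b (y j)
    + ∑ k ∈ Finset.univ.erase j, Real.arctan (y j - y k))

theorem lipschitzWith_hahnField (n : ℕ) {a b : ℂ} (ha : 0 < a.re) (hb : 0 < b.re) :
    LipschitzWith (a.re⁻¹ + b.re⁻¹ + n * 2).toNNReal (hahnField n a b) := by
  have hK : 0 ≤ a.re⁻¹ + b.re⁻¹ + n * 2 := by positivity
  refine LipschitzWith.of_dist_le_mul fun y z => ?_
  rw [Real.coe_toNNReal _ hK, dist_pi_le_iff (by positivity)]
  intro j
  have hd (k : Fin n) : |y k - z k| ≤ dist y z := dist_le_pi_dist y z k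
  have hg {c : ℂ} (hc : 0 < c.re) : |gfun c (y j) - gfun c (z j)| ≤ c.re⁻¹ * dist y z :=
    (abs_gfun_sub_gfun_le hc _ _).trans (by gcongr; exact hd j)
  have hs : |∑ k ∈ Finset.univ.erase j, Real.arctan (y j - y k)
      - ∑ k ∈ Finset.univ.erase j, Real.arctan (z j - z k)| ≤ n * 2 * dist y z := by
    rw [← Finset.sum_sub_distrib]
    calc _ ≤ ∑ k ∈ Finset.univ.erase j,
          |Real.arctan (y j - y k) - Real.arctan (z j - z k)| := Finset.abs_sum_le_sum_abs _ _
      _ ≤ ∑ _k ∈ Finset.univ.erase j, 2 * dist y z := by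
        refine Finset.sum_le_sum fun k _ => (abs_arctan_sub_arctan_le _ _).trans ?_
        have h₁ := abs_le.1 (hd j)
        have h₂ := abs_le.1 (hd k)
        rw [abs_le]
        constructor <;> linarith [h₁.1, h₁.2, h₂.1, h₂.2]
      _ ≤ ∑ _k : Fin n, 2 * dist y z :=
        Finset.sum_le_sum_of_subset_of_nonneg (Finset.subset_univ _) fun _ _ _ => by positivity
      _ = n * 2 * dist y z := by simp [mul_assoc]
  have h₁ := abs_le.1 (hg ha)
  have h₂ := abs_le.1 (hg hb)
  have h₃ := abs_le.1 hs
  rw [Real.dist_eq, abs_le]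
  simp only [hahnField]
  constructor <;> linarith [h₁.1, h₁.2, h₂.1, h₂.2, h₃.1, h₃.2]

theorem hahnField_neg_rev (n : ℕ) (a b : ℂ) (y : Fin n → ℝ) (j : Fin n) :
    hahnField n a b (fun i => -y i.rev) j = -hahnField n a b y j.rev := by
  have hs : ∑ k ∈ Finset.univ.erase j, Real.arctan (-y j.rev - -y k.rev)
      = -∑ k ∈ Finset.univ.erase j.rev, Real.arctan (y j.rev - y k) := by
    rw [← Finset.sum_neg_distrib]
    refine Finset.sum_equiv Fin.revPerm (fun k => by simp) fun k _ => ?_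
    rw [← Real.arctan_neg]
    congr 1
    simp only [Fin.revPerm_apply]
    ring
  have hj : ((j.rev : ℕ) : ℝ) = n - (j + 1) := by
    rw [Fin.val_rev, Nat.cast_sub j.isLt]
    push_cast
    rfl
  simp only [hahnField, hs, gfun_neg, hj]
  ring

/-- the continuous Hahn gradient system preserves parity symmetry: if the
initial condition satisfies `x_j(0) + x_{n+1−j}(0) = 0` for all `j`, then
`x_j(t) + x_{n+1−j}(t) = 0` for all `j` and all `t ≥ 0`.  (In Lean, the index
`n+1−j` for a 1-based index `j` is `Fin.rev j` for the 0-based index `j : Fin n`.) -/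
theorem continuousHahn_gradient_flow_parity
    (n : ℕ) (hn : 0 < n) (a b : ℂ) (ha : 0 < a.re) (hb : 0 < b.re) (hab : PairCond a b)
    (x : ℝ → Fin n → ℝ)
    (hode : ∀ t ∈ Set.Ici (0 : ℝ), ∀ j : Fin n,
      HasDerivWithinAt (fun s => x s j)
        (-((Real.pi / 2) * ((n : ℝ) + 1 - 2 * (((j : ℕ) : ℝ) + 1))
            + gfun a (x t j) + gfun b (x t j)
            + ∑ k ∈ Finset.univ.erase j, Real.arctan (x t j - x t k)))
        (Set.Ici (0 : ℝ)) t)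
    (hinit : ∀ j : Fin n, x 0 j + x 0 j.rev = 0) :
    ∀ t ∈ Set.Ici (0 : ℝ), ∀ j : Fin n, x t j + x t j.rev = 0 := by
  intro T hT
  have hderiv : ∀ t ∈ Set.Ici (0 : ℝ),
      HasDerivWithinAt x (hahnField n a b (x t)) (Set.Ici 0) t := fun t ht =>
    hasDerivWithinAt_pi.2 (hode t ht)
  have hrev : ∀ t ∈ Set.Ici (0 : ℝ), HasDerivWithinAt (fun s (i : Fin n) => -x s i.rev)
      (hahnField n a b fun i => -x t i.rev) (Set.Ici 0) t := fun t ht =>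
    hasDerivWithinAt_pi.2 fun j => by
      rw [hahnField_neg_rev]
      exact (hode t ht j.rev).neg
  have huniq := ODE_solution_unique (a := 0) (b := T) (v := fun _ => hahnField n a b)
    (fun _ => lipschitzWith_hahnField n ha hb)
    (fun t ht => (hderiv t ht.1).continuousWithinAt.mono Set.Icc_subset_Ici_self)
    (fun t ht => (hderiv t ht.1).mono (Set.Ici_subset_Ici.2 ht.1))
    (fun t ht => (hrev t ht.1).continuousWithinAt.mono Set.Icc_subset_Ici_self)
    (fun t ht => (hrev t ht.1).mono (Set.Ici_subset_Ici.2 ht.1))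
    (funext fun j => eq_neg_of_add_eq_zero_left (hinit j))
  intro j
  exact add_eq_zero_iff_eq_neg.2 (congrFun (huniq ⟨hT, le_rfl⟩) j)
end

section
/- Let (x₁*, …, xₙ*) with x₁* < ⋯ < xₙ* be the unique global minimizer of the continuous Hahn Morse function V and set Rₙ = xₙ*. Let x : [0,∞) → ℝⁿ be a differentiable solution of the gradient system dx_j/dt = −∂V/∂x_j (j = 1,…,n) whose initial condition satisfies x_j(0) + x_{n+1−j}(0) = 0 for all j = 1,…,n, and fix any κ with 0 < κ < 2⌊n/2⌋/(1 + 4Rₙ²) + Re(a)/(Re(a)² + (Rₙ + |Im(a)|)²) + Re(b)/(Re(b)² + (Rₙ + |Im(b)|)²) + (1 − (−1)ⁿ)/(2 + 2Rₙ²). Then there exists a constant K > 0 such that |x_j(t) − x_j*| ≤ K·e^{−κt} for all j = 1,…,n and all t ≥ 0. -/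
open Real Set Filter Topology

namespace ContinuousHahn

/-- Strong monotonicity of `arctan` on `[-M, M]`. -/
lemma arctan_strongly_monotone {M p q : ℝ} (hp : |p| ≤ M) (hq : |q| ≤ M) :
    (p - q) ^ 2 / (1 + M ^ 2) ≤ (p - q) * (arctan p - arctan q) := by
  wlog h : q ≤ p generalizing p q
  · have := this hq hp (le_of_not_ge h)
    linarith [show (q - p) ^ 2 = (p - q) ^ 2 by ring,
      show (q - p) * (arctan q - arctan p) = (p - q) * (arctan p - arctan q) by ring,
      congrArg (· / (1 + M ^ 2)) (show (q - p) ^ 2 = (p - q) ^ 2 by ring)]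
  have hslope : 1 / (1 + M ^ 2) * (p - q) ≤ arctan p - arctan q := by
    refine (convex_Icc (-M) M).mul_sub_le_image_sub_of_le_deriv continuous_arctan.continuousOn
      differentiable_arctan.differentiableOn ?_ q (abs_le.1 hq) p (abs_le.1 hp) h
    intro z hz
    rw [interior_Icc] at hz
    rw [Real.deriv_arctan]
    have : z ^ 2 ≤ M ^ 2 := sq_le_sq' hz.1.le hz.2.le
    exact one_div_le_one_div_of_le (by positivity) (by linarith)
  calc (p - q) ^ 2 / (1 + M ^ 2) = (p - q) * (1 / (1 + M ^ 2) * (p - q)) := by ring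
    _ ≤ _ := mul_le_mul_of_nonneg_left hslope (sub_nonneg.2 h)

lemma arctan_affine_strongly_monotone {r c M p q : ℝ} (hr : 0 < r) (hp : |p| ≤ M) (hq : |q| ≤ M) :
    r / (r ^ 2 + (M + |c|) ^ 2) * (p - q) ^ 2
      ≤ (p - q) * (arctan ((p + c) / r) - arctan ((q + c) / r)) := by
  have key : ∀ z : ℝ, |z| ≤ M → |(z + c) / r| ≤ (M + |c|) / r := by
    intro z hz
    rw [abs_div, abs_of_pos hr]
    gcongr
    exact (abs_add_le z c).trans (by gcongr)
  have h := mul_le_mul_of_nonneg_left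
    (arctan_strongly_monotone (key p hp) (key q hq)) hr.le
  have e : (p + c) / r - (q + c) / r = (p - q) / r := by ring
  rw [e] at h
  calc r / (r ^ 2 + (M + |c|) ^ 2) * (p - q) ^ 2
      = r * (((p - q) / r) ^ 2 / (1 + ((M + |c|) / r) ^ 2)) := by
        have : 0 < r ^ 2 + (M + |c|) ^ 2 := by positivity
        field_simp
    _ ≤ _ := h
    _ = _ := by field_simp

lemma gfun_strongly_monotone {a : ℂ} (ha : 0 < a.re) {M p q : ℝ} (hp : |p| ≤ M) (hq : |q| ≤ M) :
    a.re / (a.re ^ 2 + (M + |a.im|) ^ 2) * (p - q) ^ 2 ≤ (p - q) * (gfun a p - gfun a q) := by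
  have h1 := arctan_affine_strongly_monotone (c := a.im) ha hp hq
  have h2 := arctan_affine_strongly_monotone (c := -a.im) ha hp hq
  rw [abs_neg] at h2
  simp only [← sub_eq_add_neg] at h2
  unfold gfun
  linarith

lemma gfun_neg (a : ℂ) (θ : ℝ) : gfun a (-θ) = -gfun a θ := by
  unfold gfun
  rw [show (-θ + a.im) / a.re = -((θ - a.im) / a.re) by ring,
    show (-θ - a.im) / a.re = -((θ + a.im) / a.re) by ring, arctan_neg, arctan_neg]
  ring

lemma continuous_gfun (a : ℂ) : Continuous (gfun a) := by
  unfold gfun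
  simp only [div_eq_mul_inv]
  fun_prop

lemma hasDerivAt_Gfun (a : ℂ) (s : ℝ) : HasDerivAt (Gfun a) (gfun a s) s :=
  ((continuous_gfun a).integral_hasStrictDerivAt 0 s).hasDerivAt

lemma hasDerivAt_Ffun (s : ℝ) : HasDerivAt Ffun (arctan s) s :=
  (continuous_arctan.integral_hasStrictDerivAt 0 s).hasDerivAt

/-- The gradient of the Morse function. -/
noncomputable def gradV (n : ℕ) (a b : ℂ) (x : Fin n → ℝ) (j : Fin n) : ℝ :=
  (π / 2) * ((n : ℝ) + 1 - 2 * (((j : ℕ) : ℝ) + 1)) + gfun a (x j) + gfun b (x j)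
    + ∑ k ∈ Finset.univ.erase j, arctan (x j - x k)

lemma sum_erase_arctan {n : ℕ} (x : Fin n → ℝ) (j : Fin n) :
    ∑ k ∈ Finset.univ.erase j, arctan (x j - x k) = ∑ k, arctan (x j - x k) := by
  apply Finset.sum_erase
  simp

lemma sum_lt_antisymm {n : ℕ} (v : Fin n → ℝ) (f : Fin n → Fin n → ℝ)
    (hf : ∀ j k, f k j = -f j k) :
    ∑ j, ∑ k, (if j < k then (v j - v k) * f j k else 0) = ∑ j, v j * ∑ k, f j k := by
  have h1 : ∑ j, ∑ k, (if j < k then (v j - v k) * f j k else 0)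
      = ∑ j, ∑ k, (if j < k then v j * f j k else 0)
        + ∑ j, ∑ k, (if j < k then v k * f k j else 0) := by
    rw [← Finset.sum_add_distrib]
    refine Finset.sum_congr rfl fun j _ => ?_
    rw [← Finset.sum_add_distrib]
    refine Finset.sum_congr rfl fun k _ => ?_
    rw [hf j k]
    split_ifs <;> ring
  rw [h1, Finset.sum_comm (f := fun j k => if j < k then v k * f k j else 0),
    ← Finset.sum_add_distrib]
  refine Finset.sum_congr rfl fun j _ => ?_
  rw [← Finset.sum_add_distrib, Finset.mul_sum]
  refine Finset.sum_congr rfl fun k _ => ?_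
  rcases lt_trichotomy j k with h | rfl | h
  · simp [h, h.not_gt]
  · have := hf j j
    simp [show f j j = 0 by linarith]
  · simp [h, h.not_gt]

lemma hasDerivAt_V_line {n : ℕ} (a b : ℂ) (x v : Fin n → ℝ) :
    HasDerivAt (fun s : ℝ => V n a b (fun j => x j + s * v j)) (∑ j, v j * gradV n a b x j) 0 := by
  have hlin : ∀ j, HasDerivAt (fun s : ℝ => x j + s * v j) (v j) 0 := fun j => by
    simpa using ((hasDerivAt_id (0 : ℝ)).mul_const (v j)).const_add (x j)
  have hpair : ∀ j k, HasDerivAt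
      (fun s : ℝ => if j < k then Ffun ((x j + s * v j) - (x k + s * v k)) else 0)
      (if j < k then (v j - v k) * arctan (x j - x k) else 0) 0 := by
    intro j k
    split_ifs
    · have h := (hasDerivAt_Ffun ((x j + 0 * v j) - (x k + 0 * v k))).comp (0 : ℝ)
        ((hlin j).sub (hlin k))
      simpa [mul_comm, Function.comp_def] using h
    · exact hasDerivAt_const _ _
  have hsingle : ∀ j : Fin n, HasDerivAt
      (fun s : ℝ => Gfun a (x j + s * v j) + Gfun b (x j + s * v j)
        + (π / 2) * ((n : ℝ) + 1 - 2 * (((j : ℕ) : ℝ) + 1)) * (x j + s * v j))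
      (gfun a (x j) * v j + gfun b (x j) * v j
        + (π / 2) * ((n : ℝ) + 1 - 2 * (((j : ℕ) : ℝ) + 1)) * v j) 0 := by
    intro j
    have h1 := (hasDerivAt_Gfun a (x j + 0 * v j)).comp (0 : ℝ) (hlin j)
    have h2 := (hasDerivAt_Gfun b (x j + 0 * v j)).comp (0 : ℝ) (hlin j)
    have h3 := (hlin j).const_mul ((π / 2) * ((n : ℝ) + 1 - 2 * (((j : ℕ) : ℝ) + 1)))
    simp only [zero_mul, add_zero] at h1 h2
    exact (h1.add h2).add h3
  have h := (HasDerivAt.fun_sum (u := Finset.univ) fun j _ =>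
    HasDerivAt.fun_sum (u := Finset.univ) fun k _ => hpair j k).add
    (HasDerivAt.fun_sum (u := Finset.univ) fun j _ => hsingle j)
  refine h.congr_deriv ?_
  rw [sum_lt_antisymm v (fun j k => arctan (x j - x k))
    (fun j k => by rw [← arctan_neg, neg_sub]), ← Finset.sum_add_distrib]
  refine Finset.sum_congr rfl fun j _ => ?_
  rw [gradV, sum_erase_arctan]
  ring

lemma gradV_eq_zero_of_isMin {n : ℕ} {a b : ℂ} {x : Fin n → ℝ}
    (hmin : ∀ y, V n a b x ≤ V n a b y) (j : Fin n) : gradV n a b x j = 0 := by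
  have h := hasDerivAt_V_line a b x (Pi.single j 1)
  have hloc : IsLocalMin (fun s : ℝ => V n a b (fun i => x i + s * Pi.single (M := fun _ => ℝ) j 1 i))
      0 := Filter.Eventually.of_forall fun s => by
    simpa using hmin _
  simpa [Pi.single_apply] using hloc.hasDerivAt_eq_zero h

lemma sum_mul_gradV_sub {n : ℕ} (a b : ℂ) (x y : Fin n → ℝ) :
    ∑ j, (x j - y j) * (gradV n a b x j - gradV n a b y j)
      = ∑ j, ((x j - y j) * (gfun a (x j) - gfun a (y j))
          + (x j - y j) * (gfun b (x j) - gfun b (y j)))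
        + (∑ j, ∑ k, ((x j - x k) - (y j - y k)) * (arctan (x j - x k) - arctan (y j - y k))) / 2 := by
  set f : Fin n → Fin n → ℝ := fun j k => arctan (x j - x k) - arctan (y j - y k) with hf
  have hanti : ∀ j k, f k j = -f j k := fun j k => by
    simp only [hf]
    rw [← neg_sub (x j), ← neg_sub (y j), arctan_neg, arctan_neg]
    ring
  have h1 : ∑ j, ∑ k, ((x j - x k) - (y j - y k)) * f j k
      = ∑ j, ∑ k, (x j - y j) * f j k + ∑ j, ∑ k, (x k - y k) * f k j := by
    simp only [← Finset.sum_add_distrib]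
    refine Finset.sum_congr rfl fun j _ => Finset.sum_congr rfl fun k _ => ?_
    rw [hanti j k]
    ring
  rw [h1, Finset.sum_comm (f := fun j k => (x k - y k) * f k j), add_self_div_two,
    ← Finset.sum_add_distrib]
  refine Finset.sum_congr rfl fun j _ => ?_
  rw [← Finset.mul_sum, Finset.sum_sub_distrib]
  simp only [gradV, sum_erase_arctan]
  ring

/-- The parity reflection `x_j ↦ -x_{n+1-j}`. -/
def reflect {n : ℕ} (x : Fin n → ℝ) (j : Fin n) : ℝ := -x j.rev

lemma gradV_reflect {n : ℕ} (a b : ℂ) (x : Fin n → ℝ) (j : Fin n) :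
    gradV n a b (reflect x) j = -gradV n a b x j.rev := by
  have hsum : ∑ k : Fin n, arctan (-x j.rev - -x k.rev) = -∑ k, arctan (x j.rev - x k) := by
    rw [← Equiv.sum_comp Fin.revPerm (fun k => arctan (x j.rev - x k)), ← Finset.sum_neg_distrib]
    refine Finset.sum_congr rfl fun k _ => ?_
    rw [← arctan_neg, Fin.revPerm_apply]
    ring_nf
  have hcast : ((j.rev : ℕ) : ℝ) = n - (j + 1) := by
    rw [Fin.val_rev, Nat.cast_sub j.isLt]
    push_cast
    ring
  simp only [gradV, sum_erase_arctan]
  simp only [reflect, hsum, gfun_neg, hcast]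
  ring

lemma abs_le_sum_abs_add {n : ℕ} (x y : Fin n → ℝ) (j : Fin n) :
    |x j| ≤ ∑ k, (|x k| + |y k|) ∧ |y j| ≤ ∑ k, (|x k| + |y k|) := by
  have h := Finset.single_le_sum (f := fun k => |x k| + |y k|) (fun k _ => by positivity)
    (Finset.mem_univ j)
  exact ⟨by linarith [abs_nonneg (y j)], by linarith [abs_nonneg (x j)]⟩

lemma confining_strongly_monotone {n : ℕ} {a b : ℂ} (ha : 0 < a.re) (hb : 0 < b.re) {M : ℝ}
    {x y : Fin n → ℝ} (hx : ∀ j, |x j| ≤ M) (hy : ∀ j, |y j| ≤ M) :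
    (a.re / (a.re ^ 2 + (M + |a.im|) ^ 2) + b.re / (b.re ^ 2 + (M + |b.im|) ^ 2))
        * ∑ j, (x j - y j) ^ 2
      ≤ ∑ j, ((x j - y j) * (gfun a (x j) - gfun a (y j))
          + (x j - y j) * (gfun b (x j) - gfun b (y j))) := by
  rw [Finset.mul_sum]
  refine Finset.sum_le_sum fun j _ => ?_
  rw [add_mul]
  exact add_le_add (gfun_strongly_monotone ha (hx j) (hy j))
    (gfun_strongly_monotone hb (hx j) (hy j))

/-- Strong monotonicity of the gradient on a box, from the confining terms alone. -/
lemma gradV_strongly_monotone {n : ℕ} {a b : ℂ} (ha : 0 < a.re) (hb : 0 < b.re) {M : ℝ}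
    {x y : Fin n → ℝ} (hx : ∀ j, |x j| ≤ M) (hy : ∀ j, |y j| ≤ M) :
    (a.re / (a.re ^ 2 + (M + |a.im|) ^ 2) + b.re / (b.re ^ 2 + (M + |b.im|) ^ 2))
        * ∑ j, (x j - y j) ^ 2
      ≤ ∑ j, (x j - y j) * (gradV n a b x j - gradV n a b y j) := by
  rw [sum_mul_gradV_sub]
  have h1 : 0 ≤ ∑ j, ∑ k,
      ((x j - x k) - (y j - y k)) * (arctan (x j - x k) - arctan (y j - y k)) :=
    Finset.sum_nonneg fun j _ => Finset.sum_nonneg fun k _ =>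
      (by positivity : (0 : ℝ) ≤ _).trans
        (arctan_strongly_monotone (le_max_left |x j - x k| |y j - y k|) (le_max_right _ _))
  have h2 := confining_strongly_monotone ha hb hx hy
  linarith

lemma sum_mul_gradV_sub_nonneg {n : ℕ} {a b : ℂ} (ha : 0 < a.re) (hb : 0 < b.re)
    (x y : Fin n → ℝ) :
    0 ≤ ∑ j, (x j - y j) * (gradV n a b x j - gradV n a b y j) :=
  le_trans (by positivity) (gradV_strongly_monotone ha hb
    (fun j => (abs_le_sum_abs_add x y j).1) (fun j => (abs_le_sum_abs_add x y j).2))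

lemma eq_of_gradV_eq_zero {n : ℕ} {a b : ℂ} (ha : 0 < a.re) (hb : 0 < b.re)
    {x y : Fin n → ℝ} (hx : ∀ j, gradV n a b x j = 0) (hy : ∀ j, gradV n a b y j = 0) : x = y := by
  have h := gradV_strongly_monotone ha hb
    (fun j => (abs_le_sum_abs_add x y j).1) (fun j => (abs_le_sum_abs_add x y j).2)
  simp only [hx, hy, sub_zero, mul_zero, Finset.sum_const_zero] at h
  have hM : 0 ≤ ∑ k, (|x k| + |y k|) := by positivity
  have hsum : ∑ j, (x j - y j) ^ 2 = 0 :=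
    le_antisymm (nonpos_of_mul_nonpos_right h (by positivity)) (by positivity)
  funext j
  have := (Finset.sum_eq_zero_iff_of_nonneg fun j _ => sq_nonneg (x j - y j)).1 hsum j
    (Finset.mem_univ j)
  exact sub_eq_zero.1 (pow_eq_zero_iff two_ne_zero |>.1 this)

/-- The exponential rate attached to the box `|x_j| ≤ M`. -/
noncomputable def rate (n : ℕ) (a b : ℂ) (M : ℝ) : ℝ :=
  2 * ((n / 2 : ℕ) : ℝ) / (1 + 4 * M ^ 2)
    + a.re / (a.re ^ 2 + (M + |a.im|) ^ 2)
    + b.re / (b.re ^ 2 + (M + |b.im|) ^ 2)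
    + (1 - (-1 : ℝ) ^ n) / (2 + 2 * M ^ 2)

lemma one_sub_neg_one_pow_nonneg (n : ℕ) : 0 ≤ 1 - (-1 : ℝ) ^ n := by
  rcases neg_one_pow_eq_or ℝ n with h | h <;> rw [h] <;> norm_num

lemma rate_pos {n : ℕ} {a b : ℂ} (ha : 0 < a.re) (hb : 0 < b.re) (M : ℝ) : 0 < rate n a b M := by
  have := one_sub_neg_one_pow_nonneg n
  unfold rate
  positivity

lemma continuous_rate {n : ℕ} {a b : ℂ} (ha : 0 < a.re) (hb : 0 < b.re) :
    Continuous (rate n a b) := by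
  unfold rate
  refine (((Continuous.div ?_ ?_ fun M => ?_).add (Continuous.div ?_ ?_ fun M => ?_)).add
    (Continuous.div ?_ ?_ fun M => ?_)).add (Continuous.div ?_ ?_ fun M => ?_)
  all_goals first | fun_prop | positivity

lemma sum_sum_sub_sq {n : ℕ} (u : Fin n → ℝ) (hu : ∑ j, u j = 0) :
    ∑ j, ∑ k, (u j - u k) ^ 2 = 2 * n * ∑ j, u j ^ 2 := by
  have h : ∀ j k, (u j - u k) ^ 2 = u j ^ 2 - 2 * u j * u k + u k ^ 2 := fun j k => by ring
  simp only [h, Finset.sum_add_distrib, Finset.sum_sub_distrib, ← Finset.mul_sum, hu,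
    Finset.sum_const, Finset.card_univ, Fintype.card_fin, nsmul_eq_mul, mul_zero]
  ring

lemma sum_eq_zero_of_parity {n : ℕ} {x : Fin n → ℝ} (hx : ∀ j, x j + x j.rev = 0) :
    ∑ j, x j = 0 := by
  have h : ∑ j, (x j + x j.rev) = 0 := Finset.sum_eq_zero fun j _ => hx j
  rw [Finset.sum_add_distrib] at h
  have h' : ∑ j : Fin n, x j.rev = ∑ j, x j := Equiv.sum_comp Fin.revPerm x
  linarith

/-- Lower bound for the pair interaction on parity-symmetric configurations. -/
lemma pair_strongly_monotone {n : ℕ} {M : ℝ} {x y : Fin n → ℝ} (hx : ∀ j, |x j| ≤ M)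
    (hy : ∀ j, |y j| ≤ M) (hxs : ∀ j, x j + x j.rev = 0) (hys : ∀ j, y j + y j.rev = 0) :
    (2 * ((n / 2 : ℕ) : ℝ) / (1 + 4 * M ^ 2) + (1 - (-1 : ℝ) ^ n) / (2 + 2 * M ^ 2))
        * ∑ j, (x j - y j) ^ 2
      ≤ (∑ j, ∑ k,
        ((x j - x k) - (y j - y k)) * (arctan (x j - x k) - arctan (y j - y k))) / 2 := by
  set u : Fin n → ℝ := fun j => x j - y j with hu
  have hu0 : ∑ j, u j = 0 := by
    simp [hu, Finset.sum_sub_distrib, sum_eq_zero_of_parity hxs, sum_eq_zero_of_parity hys]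
  have hpair : ∀ j k, (u j - u k) ^ 2 / (1 + 4 * M ^ 2)
      ≤ ((x j - x k) - (y j - y k)) * (arctan (x j - x k) - arctan (y j - y k)) := by
    intro j k
    have h := arctan_strongly_monotone (M := 2 * M)
      ((abs_sub (x j) (x k)).trans (by linarith [hx j, hx k]))
      ((abs_sub (y j) (y k)).trans (by linarith [hy j, hy k]))
    rw [show (2 * M) ^ 2 = 4 * M ^ 2 by ring,
      show (x j - x k) - (y j - y k) = u j - u k by simp only [hu]; ring] at h
    rwa [show (x j - x k) - (y j - y k) = u j - u k by simp only [hu]; ring]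
  rcases Nat.even_or_odd n with he | ho
  · have h := Finset.sum_le_sum fun j (_ : j ∈ Finset.univ) =>
      Finset.sum_le_sum fun k (_ : k ∈ Finset.univ) => hpair j k
    simp only [← Finset.sum_div, sum_sum_sub_sq u hu0] at h
    have hn : 2 * ((n / 2 : ℕ) : ℝ) = n := by exact_mod_cast Nat.two_mul_div_two_of_even he
    rw [he.neg_one_pow, hn]
    calc _ = 2 * n * (∑ j, u j ^ 2) / (1 + 4 * M ^ 2) / 2 := by ring
      _ ≤ _ := by gcongr
  · obtain ⟨m, hm⟩ := ho
    have hmid : ∃ i : Fin n, i.rev = i := ⟨⟨m, by omega⟩, by ext; simp [Fin.val_rev]; omega⟩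
    obtain ⟨i, hi⟩ := hmid
    have hxi : x i = 0 := by have := hxs i; rw [hi] at this; linarith
    have hyi : y i = 0 := by have := hys i; rw [hi] at this; linarith
    have hui : u i = 0 := by simp [hu, hxi, hyi]
    set c : ℝ := 1 / (1 + M ^ 2) - 1 / (1 + 4 * M ^ 2) with hc
    have hsingle : ∀ k, u k ^ 2 / (1 + M ^ 2) ≤ u k * (arctan (x k) - arctan (y k)) := fun k =>
      arctan_strongly_monotone (hx k) (hy k)
    have hpair' : ∀ j k, (u j - u k) ^ 2 / (1 + 4 * M ^ 2)
          + c * ((if j = i then u k ^ 2 else 0) + (if k = i then u j ^ 2 else 0))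
        ≤ ((x j - x k) - (y j - y k)) * (arctan (x j - x k) - arctan (y j - y k)) := by
      intro j k
      by_cases hj : j = i
      · subst hj
        by_cases hk : k = j
        · subst hk
          simp [hui]
        · have h := hsingle k
          simp only [hxi, hyi, hui, hk, if_true, if_false, zero_sub, arctan_neg, hc]
          calc _ = u k ^ 2 / (1 + M ^ 2) := by ring
            _ ≤ _ := h
            _ = _ := by simp only [hu]; ring
      · by_cases hk : k = i
        · subst hk
          have h := hsingle j
          simp only [hxi, hyi, hui, hj, if_true, if_false, sub_zero, hc]
          calc _ = u j ^ 2 / (1 + M ^ 2) := by ring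
            _ ≤ _ := h
        · simpa [hj, hk] using hpair j k
    have h := Finset.sum_le_sum fun j (_ : j ∈ Finset.univ) =>
      Finset.sum_le_sum fun k (_ : k ∈ Finset.univ) => hpair' j k
    have hmidsum : ∑ j, ∑ k, ((if j = i then u k ^ 2 else 0) + (if k = i then u j ^ 2 else 0))
        = 2 * ∑ j, u j ^ 2 := by
      simp only [Finset.sum_add_distrib, Finset.sum_ite_eq', Finset.mem_univ, if_true]
      rw [Finset.sum_comm]
      simp only [Finset.sum_ite_eq', Finset.mem_univ, if_true]
      ring
    simp only [Finset.sum_add_distrib (f := fun _ => (_ : ℝ) / _), ← Finset.sum_div,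
      sum_sum_sub_sq u hu0, ← Finset.mul_sum] at h
    rw [hmidsum] at h
    have hn : 2 * ((n / 2 : ℕ) : ℝ) = n - 1 := by
      rw [hm, show (2 * m + 1) / 2 = m by omega]
      push_cast
      ring
    rw [Odd.neg_one_pow ⟨m, hm⟩, hn]
    calc _ = (2 * n * (∑ j, u j ^ 2) / (1 + 4 * M ^ 2) + c * (2 * ∑ j, u j ^ 2)) / 2 := by
            rw [hc]
            have h1 : (0 : ℝ) < 1 + M ^ 2 := by positivity
            have h2 : (0 : ℝ) < 1 + 4 * M ^ 2 := by positivity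
            rw [show (2 : ℝ) + 2 * M ^ 2 = 2 * (1 + M ^ 2) by ring]
            field_simp
            ring
      _ ≤ _ := by gcongr

lemma gradV_strongly_monotone_of_parity {n : ℕ} {a b : ℂ} (ha : 0 < a.re) (hb : 0 < b.re) {M : ℝ}
    {x y : Fin n → ℝ} (hx : ∀ j, |x j| ≤ M) (hy : ∀ j, |y j| ≤ M)
    (hxs : ∀ j, x j + x j.rev = 0) (hys : ∀ j, y j + y j.rev = 0) :
    rate n a b M * ∑ j, (x j - y j) ^ 2
      ≤ ∑ j, (x j - y j) * (gradV n a b x j - gradV n a b y j) := by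
  rw [sum_mul_gradV_sub]
  refine le_trans (le_of_eq ?_) (add_le_add (confining_strongly_monotone ha hb hx hy)
    (pair_strongly_monotone hx hy hxs hys))
  unfold rate
  ring

/-- `x` solves the gradient system on `[0, ∞)`. -/
def IsGradientFlow (n : ℕ) (a b : ℂ) (x : ℝ → Fin n → ℝ) : Prop :=
  ∀ t ∈ Ici (0 : ℝ), ∀ j : Fin n,
    HasDerivWithinAt (fun s => x s j) (-gradV n a b (x t) j) (Ici (0 : ℝ)) t

lemma IsGradientFlow.reflect {n : ℕ} {a b : ℂ} {x : ℝ → Fin n → ℝ}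
    (hx : IsGradientFlow n a b x) : IsGradientFlow n a b (fun t => reflect (x t)) := by
  intro t ht j
  rw [gradV_reflect]
  exact (hx t ht j.rev).neg

lemma isGradientFlow_const {n : ℕ} {a b : ℂ} {y : Fin n → ℝ} (hy : ∀ j, gradV n a b y j = 0) :
    IsGradientFlow n a b (fun _ => y) := by
  intro t _ j
  rw [hy, neg_zero]
  exact hasDerivWithinAt_const _ _ _

lemma IsGradientFlow.hasDerivWithinAt_sq_dist {n : ℕ} {a b : ℂ} {x y : ℝ → Fin n → ℝ}
    (hx : IsGradientFlow n a b x) (hy : IsGradientFlow n a b y) {t : ℝ} (ht : t ∈ Ici (0 : ℝ)) :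
    HasDerivWithinAt (fun s => ∑ j, (x s j - y s j) ^ 2)
      (-2 * ∑ j, (x t j - y t j) * (gradV n a b (x t) j - gradV n a b (y t) j)) (Ici 0) t := by
  refine (HasDerivWithinAt.fun_sum (u := Finset.univ) fun j _ =>
    ((hx t ht j).sub (hy t ht j)).pow 2).congr_deriv ?_
  rw [Finset.mul_sum]
  refine Finset.sum_congr rfl fun j _ => ?_
  simp only [Pi.sub_apply]
  push_cast
  ring

/-- Differential form of Grönwall's inequality on `[T, ∞)`. -/
lemma le_exp_decay {E E' : ℝ → ℝ} {T c : ℝ} (hT : 0 ≤ T)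
    (hE : ∀ t ∈ Ici (0 : ℝ), HasDerivWithinAt E (E' t) (Ici 0) t)
    (hle : ∀ t, T ≤ t → E' t ≤ -c * E t) {t : ℝ} (ht : T ≤ t) :
    E t ≤ E T * exp (-c * (t - T)) := by
  have hder : ∀ s, T ≤ s → HasDerivWithinAt (fun s => E s * exp (c * s))
      (E' s * exp (c * s) + E s * (exp (c * s) * c)) (Ici T) s := by
    intro s hs
    have h1 := (hE s (hT.trans hs)).mono (Ici_subset_Ici.2 hT)
    have h2 : HasDerivAt (fun s => exp (c * s)) (exp (c * s) * c) s := by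
      simpa using ((hasDerivAt_id s).const_mul c).exp
    exact h1.mul h2.hasDerivWithinAt
  have hanti : AntitoneOn (fun s => E s * exp (c * s)) (Ici T) := by
    refine antitoneOn_of_hasDerivWithinAt_nonpos (convex_Ici T)
      (fun s hs => (hder s hs).continuousWithinAt)
      (fun s hs => (hder s (interior_subset hs)).mono interior_subset) fun s hs => ?_
    have h := mul_le_mul_of_nonneg_right (hle s (interior_subset hs)) (exp_pos (c * s)).le
    linarith
  have h := hanti self_mem_Ici ht ht
  simp only at h
  calc E t = E t * exp (c * t) * exp (-(c * t)) := by
        rw [mul_assoc, ← exp_add]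
        simp
    _ ≤ E T * exp (c * T) * exp (-(c * t)) := by gcongr
    _ = _ := by
      rw [mul_assoc, ← exp_add]
      ring_nf

lemma IsGradientFlow.sq_dist_le {n : ℕ} {a b : ℂ} (ha : 0 < a.re) (hb : 0 < b.re)
    {x y : ℝ → Fin n → ℝ} (hx : IsGradientFlow n a b x) (hy : IsGradientFlow n a b y)
    {t : ℝ} (ht : 0 ≤ t) : ∑ j, (x t j - y t j) ^ 2 ≤ ∑ j, (x 0 j - y 0 j) ^ 2 := by
  have h := le_exp_decay (c := 0) le_rfl (fun s hs => hx.hasDerivWithinAt_sq_dist hy hs)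
    (fun s _ => by linarith [sum_mul_gradV_sub_nonneg ha hb (x s) (y s)]) ht
  simpa using h

lemma IsGradientFlow.parity {n : ℕ} {a b : ℂ} (ha : 0 < a.re) (hb : 0 < b.re)
    {x : ℝ → Fin n → ℝ} (hx : IsGradientFlow n a b x) (h0 : ∀ j, x 0 j + x 0 j.rev = 0)
    {t : ℝ} (ht : 0 ≤ t) (j : Fin n) : x t j + x t j.rev = 0 := by
  have h := hx.sq_dist_le ha hb hx.reflect ht
  simp only [ContinuousHahn.reflect, sub_neg_eq_add, h0] at h
  have hsum : ∑ j, (x t j + x t j.rev) ^ 2 = 0 :=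
    le_antisymm (by simpa using h) (by positivity)
  have := (Finset.sum_eq_zero_iff_of_nonneg fun j _ => sq_nonneg (x t j + x t j.rev)).1 hsum j
    (Finset.mem_univ j)
  exact pow_eq_zero_iff two_ne_zero |>.1 this

/-- A parity-symmetric flow that stays `r`-close to a symmetric equilibrium in the box
`|y_j| ≤ R` from time `T` on converges with the rate of the box `|x_j| ≤ R + r`. -/
lemma IsGradientFlow.sq_dist_le_exp {n : ℕ} {a b : ℂ} (ha : 0 < a.re) (hb : 0 < b.re)
    {x : ℝ → Fin n → ℝ} (hx : IsGradientFlow n a b x) (h0 : ∀ j, x 0 j + x 0 j.rev = 0)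
    {y : Fin n → ℝ} (hy : ∀ j, gradV n a b y j = 0) (hys : ∀ j, y j + y j.rev = 0)
    {R r T : ℝ} (hR : ∀ j, |y j| ≤ R) (hr : 0 ≤ r) (hT : 0 ≤ T)
    (hclose : ∀ t, T ≤ t → ∑ j, (x t j - y j) ^ 2 ≤ r ^ 2) {t : ℝ} (ht : T ≤ t) :
    ∑ j, (x t j - y j) ^ 2
      ≤ (∑ j, (x T j - y j) ^ 2) * exp (-(2 * rate n a b (R + r)) * (t - T)) := by
  refine le_exp_decay (E := fun t => ∑ j, (x t j - y j) ^ 2) hT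
    (fun s hs => hx.hasDerivWithinAt_sq_dist (isGradientFlow_const hy) hs) (fun s hs => ?_) ht
  have hbox : ∀ j, |x s j| ≤ R + r := by
    intro j
    have h1 : |x s j - y j| ≤ r := by
      refine abs_le_of_sq_le_sq ?_ hr
      exact (Finset.single_le_sum (f := fun j => (x s j - y j) ^ 2) (fun j _ => sq_nonneg _)
        (Finset.mem_univ j)).trans (hclose s hs)
    calc |x s j| = |y j + (x s j - y j)| := by ring_nf
      _ ≤ |y j| + |x s j - y j| := abs_add_le _ _
      _ ≤ R + r := add_le_add (hR j) h1
  have h := gradV_strongly_monotone_of_parity ha hb hbox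
    (fun j => (hR j).trans (by linarith)) (fun j => hx.parity ha hb h0 (hT.trans hs) j) hys
  linarith

lemma IsGradientFlow.exponential_convergence {n : ℕ} {a b : ℂ} (ha : 0 < a.re) (hb : 0 < b.re)
    {x : ℝ → Fin n → ℝ} (hx : IsGradientFlow n a b x) (h0 : ∀ j, x 0 j + x 0 j.rev = 0)
    {y : Fin n → ℝ} (hy : ∀ j, gradV n a b y j = 0) (hys : ∀ j, y j + y j.rev = 0)
    {R κ : ℝ} (hR : ∀ j, |y j| ≤ R) (hκ0 : 0 < κ) (hκ : κ < rate n a b R) :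
    ∃ K > (0 : ℝ), ∀ j : Fin n, ∀ t ∈ Ici (0 : ℝ), |x t j - y j| ≤ K * exp (-κ * t) := by
  set E : ℝ → ℝ := fun t => ∑ j, (x t j - y j) ^ 2 with hE
  have hE0 : ∀ t, 0 ≤ E t := fun t => by positivity
  have hmono : ∀ t, 0 ≤ t → E t ≤ E 0 := fun t ht =>
    hx.sq_dist_le ha hb (isGradientFlow_const hy) ht
  obtain ⟨r, hr, hκr⟩ : ∃ r > 0, κ < rate n a b (R + r) := by
    have hcont : ContinuousAt (fun r => rate n a b (R + r)) 0 :=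
      ((continuous_rate ha hb).comp (continuous_const.add continuous_id)).continuousAt
    have hev : ∀ᶠ r in 𝓝[>] (0 : ℝ), κ < rate n a b (R + r) :=
      nhdsWithin_le_nhds (hcont.eventually_const_lt (by simpa using hκ))
    obtain ⟨r, h1, h2⟩ := (hev.and self_mem_nhdsWithin).exists
    exact ⟨r, h2, h1⟩
  obtain ⟨T, hT, hclose⟩ : ∃ T, 0 ≤ T ∧ ∀ t, T ≤ t → E t ≤ r ^ 2 := by
    have hdecay : ∀ t, 0 ≤ t →
        E t ≤ E 0 * exp (-(2 * rate n a b (R + √(E 0))) * (t - 0)) := fun t ht =>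
      hx.sq_dist_le_exp ha hb h0 hy hys hR (sqrt_nonneg _) le_rfl
        (fun s hs => by rw [sq_sqrt (hE0 0)]; exact hmono s hs) ht
    have hc : 0 < 2 * rate n a b (R + √(E 0)) := mul_pos two_pos (rate_pos ha hb _)
    have hlim : Tendsto (fun t : ℝ => E 0 * exp (-(2 * rate n a b (R + √(E 0))) * (t - 0)))
        atTop (𝓝 (E 0 * 0)) := by
      refine Tendsto.const_mul _ (tendsto_exp_atBot.comp ?_)
      simp only [sub_zero]
      exact tendsto_id.const_mul_atTop_of_neg (neg_neg_of_pos hc)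
    rw [mul_zero] at hlim
    obtain ⟨T, hT⟩ := eventually_atTop.1 (hlim.eventually_le_const (show 0 < r ^ 2 by positivity))
    exact ⟨max T 0, le_max_right _ _, fun t ht =>
      (hdecay t ((le_max_right _ _).trans ht)).trans (hT t ((le_max_left _ _).trans ht))⟩
  have hbound : ∀ t, 0 ≤ t → E t ≤ E 0 * exp (-(2 * κ) * (t - T)) := by
    intro t ht
    rcases le_total T t with h | h
    · calc E t ≤ E T * exp (-(2 * rate n a b (R + r)) * (t - T)) :=
            hx.sq_dist_le_exp ha hb h0 hy hys hR hr.le hT hclose h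
        _ ≤ E 0 * exp (-(2 * κ) * (t - T)) := by
            have h1 := hmono T hT
            have h2 := sub_nonneg.2 h
            have h3 := hE0 0
            gcongr
    · refine (hmono t ht).trans (le_mul_of_one_le_right (hE0 0) (one_le_exp ?_))
      nlinarith
  refine ⟨√(E 0 + 1) * exp (κ * T), by have := hE0 0; positivity, fun j t ht => ?_⟩
  refine abs_le_of_sq_le_sq ?_ (by positivity)
  calc (x t j - y j) ^ 2 ≤ E t :=
        Finset.single_le_sum (f := fun j => (x t j - y j) ^ 2) (fun j _ => sq_nonneg _)
          (Finset.mem_univ j)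
    _ ≤ E 0 * exp (-(2 * κ) * (t - T)) := hbound t ht
    _ ≤ (E 0 + 1) * exp (-(2 * κ) * (t - T)) := by gcongr; linarith
    _ = (√(E 0 + 1) * exp (κ * T) * exp (-κ * t)) ^ 2 := by
      rw [mul_assoc, ← exp_add, mul_pow, sq_sqrt (by linarith [hE0 0]), ← exp_nat_mul]
      push_cast
      ring_nf

end ContinuousHahn

/-- improved exponential convergence of the continuous Hahn gradient flow
for parity-symmetric initial conditions `x_j(0) + x_{n+1−j}(0) = 0`: with
`x* = (x₁*, …, xₙ*)` the unique global minimizer of `V` (with `x₁* < ⋯ < xₙ*`,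
`Rₙ = xₙ*`), for any
`0 < κ < 2⌊n/2⌋/(1+4Rₙ²) + Re a/(Re²a+(Rₙ+|Im a|)²) + Re b/(Re²b+(Rₙ+|Im b|)²)
        + (1−(−1)ⁿ)/(2+2Rₙ²)`
there is `K > 0` with `|x_j(t) − x_j*| ≤ K e^{−κt}` for all `j` and `t ≥ 0`. -/
theorem continuousHahn_gradient_flow_symmetric_exponential_convergence
    (n : ℕ) (hn : 0 < n) (a b : ℂ) (ha : 0 < a.re) (hb : 0 < b.re) (hab : PairCond a b)
    (xs : Fin n → ℝ) (hmin : ∀ y : Fin n → ℝ, V n a b xs ≤ V n a b y)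
    (hmono : StrictMono xs)
    (x : ℝ → Fin n → ℝ)
    (hode : ∀ t ∈ Set.Ici (0 : ℝ), ∀ j : Fin n,
      HasDerivWithinAt (fun s => x s j)
        (-((Real.pi / 2) * ((n : ℝ) + 1 - 2 * (((j : ℕ) : ℝ) + 1))
            + gfun a (x t j) + gfun b (x t j)
            + ∑ k ∈ Finset.univ.erase j, Real.arctan (x t j - x t k)))
        (Set.Ici (0 : ℝ)) t)
    (hinit : ∀ j : Fin n, x 0 j + x 0 j.rev = 0)
    (κ : ℝ) (hκ0 : 0 < κ)
    (hκ : κ < 2 * ((n / 2 : ℕ) : ℝ) / (1 + 4 * (xs ⟨n - 1, by omega⟩) ^ 2)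
             + a.re / (a.re ^ 2 + (xs ⟨n - 1, by omega⟩ + |a.im|) ^ 2)
             + b.re / (b.re ^ 2 + (xs ⟨n - 1, by omega⟩ + |b.im|) ^ 2)
             + (1 - (-1 : ℝ) ^ n) / (2 + 2 * (xs ⟨n - 1, by omega⟩) ^ 2)) :
    ∃ K > (0 : ℝ), ∀ j : Fin n, ∀ t ∈ Set.Ici (0 : ℝ),
      |x t j - xs j| ≤ K * Real.exp (-κ * t) := by
  have hcrit := ContinuousHahn.gradV_eq_zero_of_isMin hmin
  have hsymm : ∀ j, xs j + xs j.rev = 0 := by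
    intro j
    have h := congrFun (ContinuousHahn.eq_of_gradV_eq_zero ha hb hcrit
      (y := ContinuousHahn.reflect xs)
      (fun j => by rw [ContinuousHahn.gradV_reflect, hcrit, neg_zero])) j
    simp only [ContinuousHahn.reflect] at h
    linarith
  have hle : ∀ j, xs j ≤ xs ⟨n - 1, by omega⟩ := fun j =>
    hmono.monotone (Fin.le_def.2 (Nat.le_sub_one_of_lt j.isLt))
  have hR : ∀ j, |xs j| ≤ xs ⟨n - 1, by omega⟩ := fun j =>
    abs_le.2 ⟨by linarith [hsymm j, hle j.rev], hle j⟩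
  exact ContinuousHahn.IsGradientFlow.exponential_convergence ha hb hode hinit hcrit hsymm hR
    hκ0 hκ
end
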